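/- Let M ≥ 1 and q ≥ 1 be integers, λ > 0, and let (d_j, c_j)_{j∈J} be a finite collection with d_j ∈ ℝ^q and c_j ∈ {1,…,M+1}. For f = (f_1,…,f_M) ∈ (ℝ^q)^M define the regularized log-likelihood L(f) = Σ_{j∈J} log z_{c_j}(d_j, f) − (λ/2)·‖f‖₂², and define g(f) ∈ (ℝ^q)^M by g(f)_i = λ f_i + Σ_{j∈J} z_i(d_j, f) d_j. For f¹, f² ∈ (ℝ^q)^M define B_j(f¹,f²) = ∫₀¹ A(d_j, v f¹ + (1−v) f²) dv ∈ ℝ^{M×M} and G(f¹,f²) = λ I_{Mq} + Σ_{j∈J} B_j(f¹,f²) ⊗ d_j d_jᵀ (identifying (ℝ^q)^M with ℝ^{Mq} blockwise, ⊗ the Kronecker product); G(f¹,f²) is symmetric positive definite, hence invertible. If f̂ ∈ (ℝ^q)^M is a global maximizer of L over (ℝ^q)^M, then for every f ∈ (ℝ^q)^M: L(f̂) − L(f) ≤ ( g(f) − g(f̂) )ᵀ G(f, f̂)^{−1} ( g(f) − g(f̂) ). -/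

import Mathlib

open Finset Matrix Kronecker

/-- Multinomial logistic probability
`z_i(d, f) = exp ⟨f_i, d⟩ / (1 + ∑_m exp ⟨f_m, d⟩)` for `i ∈ {1, …, M}`. -/
noncomputable def mnlProb {M q : ℕ} (d : Fin q → ℝ) (f : Fin M → Fin q → ℝ) (i : Fin M) : ℝ :=
  Real.exp (f i ⬝ᵥ d) / (1 + ∑ m, Real.exp (f m ⬝ᵥ d))

/-- Multinomial logistic probability for all `M + 1` classes: the last class has probability
`z_{M+1}(d, f) = 1 / (1 + ∑_m exp ⟨f_m, d⟩)`. -/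
noncomputable def mnlProbFull {M q : ℕ} (d : Fin q → ℝ) (f : Fin M → Fin q → ℝ)
    (c : Fin (M + 1)) : ℝ :=
  (if h : (c : ℕ) < M then Real.exp (f ⟨c, h⟩ ⬝ᵥ d) else 1) /
    (1 + ∑ m, Real.exp (f m ⬝ᵥ d))

/-- The multinomial logistic curvature matrix
`A(d, f) = diag(z(d,f)) - z(d,f) z(d,f)ᵀ ∈ ℝ^{M×M}`. -/
noncomputable def mnlCurv {M q : ℕ} (d : Fin q → ℝ) (f : Fin M → Fin q → ℝ) :
    Matrix (Fin M) (Fin M) ℝ :=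
  Matrix.diagonal (mnlProb d f) - Matrix.vecMulVec (mnlProb d f) (mnlProb d f)

/-- Blockwise identification of `(ℝ^q)^M` with `ℝ^{M·q}`. -/
def vecFlatten {M q : ℕ} (f : Fin M → Fin q → ℝ) : Fin M × Fin q → ℝ := fun p => f p.1 p.2

/-- The λ-regularized multinomial logistic log-likelihood
`L(f) = ∑_j log z_{c_j}(d_j, f) - (λ/2) ‖f‖²`. -/
noncomputable def mnlLogLik {M q : ℕ} {J : Type*} [Fintype J] (lam : ℝ)
    (d : J → Fin q → ℝ) (c : J → Fin (M + 1)) (f : Fin M → Fin q → ℝ) : ℝ :=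
  (∑ j, Real.log (mnlProbFull (d j) f (c j))) - lam / 2 * ∑ i, ∑ x, f i x ^ 2

/-- The gradient map `g(f)_i = λ f_i + ∑_j z_i(d_j, f) d_j`. -/
noncomputable def mnlGradMap {M q : ℕ} {J : Type*} [Fintype J] (lam : ℝ)
    (d : J → Fin q → ℝ) (f : Fin M → Fin q → ℝ) : Fin M → Fin q → ℝ := fun i =>
  lam • f i + ∑ j, mnlProb (d j) f i • d j

/-- The averaged curvature matrix `B_j(f¹, f²) = ∫₀¹ A(d_j, v f¹ + (1-v) f²) dv`. -/
noncomputable def mnlAvgCurv {M q : ℕ} (d : Fin q → ℝ) (f₁ f₂ : Fin M → Fin q → ℝ) :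
    Matrix (Fin M) (Fin M) ℝ := fun a b =>
  ∫ v in (0 : ℝ)..1, mnlCurv d (v • f₁ + (1 - v) • f₂) a b

/-- The matrix `G(f¹, f²) = λ I + ∑_j B_j(f¹, f²) ⊗ d_j d_jᵀ`. -/
noncomputable def mnlDesign {M q : ℕ} {J : Type*} [Fintype J] (lam : ℝ)
    (d : J → Fin q → ℝ) (f₁ f₂ : Fin M → Fin q → ℝ) :
    Matrix (Fin M × Fin q) (Fin M × Fin q) ℝ :=
  lam • (1 : Matrix (Fin M × Fin q) (Fin M × Fin q) ℝ) +
    ∑ j, (mnlAvgCurv (d j) f₁ f₂) ⊗ₖ Matrix.vecMulVec (d j) (d j)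

theorem one_add_sum_exp_pos {M q : ℕ} (d : Fin q → ℝ) (f : Fin M → Fin q → ℝ) :
    0 < 1 + ∑ m, Real.exp (f m ⬝ᵥ d) := by positivity

theorem mnlProb_nonneg {M q : ℕ} (d : Fin q → ℝ) (f : Fin M → Fin q → ℝ) (i : Fin M) :
    0 ≤ mnlProb d f i := by
  unfold mnlProb; positivity

theorem sum_mnlProb_le_one {M q : ℕ} (d : Fin q → ℝ) (f : Fin M → Fin q → ℝ) :
    ∑ i, mnlProb d f i ≤ 1 := by
  simp only [mnlProb]
  rw [← Finset.sum_div, div_le_one (one_add_sum_exp_pos d f)]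
  linarith

theorem mnlCurv_mulVec {M q : ℕ} (d : Fin q → ℝ) (f : Fin M → Fin q → ℝ) (s : Fin M → ℝ)
    (a : Fin M) :
    (mnlCurv d f *ᵥ s) a = mnlProb d f a * (s a - ∑ b, mnlProb d f b * s b) := by
  simp only [mnlCurv, Matrix.sub_mulVec, Pi.sub_apply, Matrix.mulVec_diagonal, mul_sub]
  simp [Matrix.mulVec, dotProduct, Matrix.vecMulVec_apply, Finset.mul_sum, mul_assoc]

theorem mnlCurv_symm {M q : ℕ} (d : Fin q → ℝ) (f : Fin M → Fin q → ℝ) (a b : Fin M) :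
    mnlCurv d f a b = mnlCurv d f b a := by
  simp only [mnlCurv, Matrix.sub_apply, Matrix.vecMulVec_apply, Matrix.diagonal_apply]
  by_cases h : a = b
  · subst h; rfl
  · simp [h, Ne.symm h, mul_comm]

theorem dotProduct_mnlCurv_mulVec_nonneg {M q : ℕ} (d : Fin q → ℝ) (f : Fin M → Fin q → ℝ)
    (s : Fin M → ℝ) : 0 ≤ s ⬝ᵥ (mnlCurv d f *ᵥ s) := by
  have hquad : s ⬝ᵥ (mnlCurv d f *ᵥ s) =
      ∑ a, mnlProb d f a * s a ^ 2 - (∑ a, mnlProb d f a * s a) ^ 2 := by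
    simp only [dotProduct, mnlCurv_mulVec]
    rw [sq (∑ a, _), Finset.sum_mul, ← Finset.sum_sub_distrib]
    exact Finset.sum_congr rfl fun a _ => by ring
  have hcs := Finset.sum_sq_le_sum_mul_sum_of_sq_le_mul Finset.univ
    (r := fun a => mnlProb d f a * s a) (f := mnlProb d f)
    (g := fun a => mnlProb d f a * s a ^ 2) (fun a _ => mnlProb_nonneg d f a)
    (fun a _ => mul_nonneg (mnlProb_nonneg d f a) (sq_nonneg _)) (fun a _ => by
      apply le_of_eq; ring)
  have hnn : 0 ≤ ∑ a, mnlProb d f a * s a ^ 2 :=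
    Finset.sum_nonneg fun a _ => mul_nonneg (mnlProb_nonneg d f a) (sq_nonneg _)
  have := mul_le_of_le_one_left hnn (sum_mnlProb_le_one d f)
  rw [hquad]
  linarith

theorem hasDerivAt_segment_dotProduct {M q : ℕ} (d : Fin q → ℝ) (f₁ f₂ : Fin M → Fin q → ℝ)
    (a : Fin M) (v : ℝ) :
    HasDerivAt (fun v : ℝ => (v • f₁ + (1 - v) • f₂) a ⬝ᵥ d) ((f₁ a - f₂ a) ⬝ᵥ d) v := by
  have heq : (fun v : ℝ => (v • f₁ + (1 - v) • f₂) a ⬝ᵥ d) =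
      fun v : ℝ => v * ((f₁ a - f₂ a) ⬝ᵥ d) + f₂ a ⬝ᵥ d := by
    funext v
    simp only [Pi.add_apply, Pi.smul_apply, add_dotProduct, sub_dotProduct, smul_dotProduct,
      smul_eq_mul]
    ring
  rw [heq]
  simpa using ((hasDerivAt_id v).mul_const ((f₁ a - f₂ a) ⬝ᵥ d)).add_const (f₂ a ⬝ᵥ d)

theorem hasDerivAt_segment_one_add_sum_exp {M q : ℕ} (d : Fin q → ℝ)
    (f₁ f₂ : Fin M → Fin q → ℝ) (v : ℝ) :
    HasDerivAt (fun v : ℝ => 1 + ∑ m, Real.exp ((v • f₁ + (1 - v) • f₂) m ⬝ᵥ d))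
      (∑ m, Real.exp ((v • f₁ + (1 - v) • f₂) m ⬝ᵥ d) * ((f₁ m - f₂ m) ⬝ᵥ d)) v :=
  (HasDerivAt.fun_sum fun m _ => (hasDerivAt_segment_dotProduct d f₁ f₂ m v).exp).const_add 1

theorem hasDerivAt_mnlProb_segment {M q : ℕ} (d : Fin q → ℝ) (f₁ f₂ : Fin M → Fin q → ℝ)
    (a : Fin M) (v : ℝ) :
    HasDerivAt (fun v : ℝ => mnlProb d (v • f₁ + (1 - v) • f₂) a)
      ((mnlCurv d (v • f₁ + (1 - v) • f₂) *ᵥ fun b => (f₁ b - f₂ b) ⬝ᵥ d) a) v := by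
  have hpos := one_add_sum_exp_pos d (v • f₁ + (1 - v) • f₂)
  refine ((hasDerivAt_segment_dotProduct d f₁ f₂ a v).exp.fun_div
    (hasDerivAt_segment_one_add_sum_exp d f₁ f₂ v) hpos.ne').congr_deriv ?_
  rw [mnlCurv_mulVec]
  simp only [mnlProb, div_mul_eq_mul_div]
  rw [← Finset.sum_div]
  field_simp

theorem hasDerivAt_log_mnlProbFull_segment {M q : ℕ} (d : Fin q → ℝ)
    (f₁ f₂ : Fin M → Fin q → ℝ) (c : Fin (M + 1)) (v : ℝ) :
    HasDerivAt (fun v : ℝ => Real.log (mnlProbFull d (v • f₁ + (1 - v) • f₂) c))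
      ((if h : (c : ℕ) < M then (f₁ ⟨c, h⟩ - f₂ ⟨c, h⟩) ⬝ᵥ d else 0) -
        ∑ b, mnlProb d (v • f₁ + (1 - v) • f₂) b * ((f₁ b - f₂ b) ⬝ᵥ d)) v := by
  have hlog : HasDerivAt
      (fun v : ℝ => Real.log (1 + ∑ m, Real.exp ((v • f₁ + (1 - v) • f₂) m ⬝ᵥ d)))
      (∑ b, mnlProb d (v • f₁ + (1 - v) • f₂) b * ((f₁ b - f₂ b) ⬝ᵥ d)) v := by
    refine ((hasDerivAt_segment_one_add_sum_exp d f₁ f₂ v).log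
      (one_add_sum_exp_pos d _).ne').congr_deriv ?_
    simp only [mnlProb, div_mul_eq_mul_div]
    rw [← Finset.sum_div]
  by_cases h : (c : ℕ) < M
  · simp only [mnlProbFull, h, dite_true]
    refine ((hasDerivAt_segment_dotProduct d f₁ f₂ ⟨c, h⟩ v).fun_sub hlog).congr_of_eventuallyEq
      (Filter.Eventually.of_forall fun w => ?_)
    simp only [Real.log_div (Real.exp_ne_zero _) (one_add_sum_exp_pos d _).ne', Real.log_exp]
  · simp only [mnlProbFull, h, dite_false]
    refine ((hasDerivAt_const v 0).fun_sub hlog).congr_of_eventuallyEq (Filter.Eventually.of_forall fun w => ?_)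
    simp only [Real.log_div one_ne_zero (one_add_sum_exp_pos d _).ne', Real.log_one]

theorem continuous_mnlCurv_segment {M q : ℕ} (d : Fin q → ℝ) (f₁ f₂ : Fin M → Fin q → ℝ)
    (a b : Fin M) : Continuous fun v : ℝ => mnlCurv d (v • f₁ + (1 - v) • f₂) a b := by
  have hc (i : Fin M) : Continuous fun v : ℝ => mnlProb d (v • f₁ + (1 - v) • f₂) i :=
    continuous_iff_continuousAt.2 fun v => (hasDerivAt_mnlProb_segment d f₁ f₂ i v).continuousAt
  simp only [mnlCurv, Matrix.sub_apply, Matrix.vecMulVec_apply, Matrix.diagonal_apply]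
  by_cases h : a = b
  · simp only [h, if_true]
    exact (hc b).sub ((hc b).mul (hc b))
  · simp only [h, if_false]
    exact continuous_const.sub ((hc a).mul (hc b))

theorem continuous_mnlCurv_segment_mulVec {M q : ℕ} (d : Fin q → ℝ)
    (f₁ f₂ : Fin M → Fin q → ℝ) (s : Fin M → ℝ) (a : Fin M) :
    Continuous fun v : ℝ => (mnlCurv d (v • f₁ + (1 - v) • f₂) *ᵥ s) a := by
  simp only [Matrix.mulVec, dotProduct]
  exact continuous_finsetSum _ fun b _ =>
    (continuous_mnlCurv_segment d f₁ f₂ a b).fun_mul continuous_const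

theorem mnlAvgCurv_mulVec {M q : ℕ} (d : Fin q → ℝ) (f₁ f₂ : Fin M → Fin q → ℝ)
    (s : Fin M → ℝ) (a : Fin M) :
    (mnlAvgCurv d f₁ f₂ *ᵥ s) a =
      ∫ v in (0 : ℝ)..1, (mnlCurv d (v • f₁ + (1 - v) • f₂) *ᵥ s) a := by
  simp only [Matrix.mulVec, dotProduct, mnlAvgCurv]
  rw [intervalIntegral.integral_finsetSum fun b _ =>
    ((continuous_mnlCurv_segment d f₁ f₂ a b).fun_mul continuous_const).intervalIntegrable _ _]
  simp only [intervalIntegral.integral_mul_const]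

theorem mnlAvgCurv_mulVec_sub {M q : ℕ} (d : Fin q → ℝ) (f₁ f₂ : Fin M → Fin q → ℝ)
    (a : Fin M) :
    (mnlAvgCurv d f₁ f₂ *ᵥ fun b => (f₁ b - f₂ b) ⬝ᵥ d) a = mnlProb d f₁ a - mnlProb d f₂ a := by
  rw [mnlAvgCurv_mulVec, intervalIntegral.integral_eq_sub_of_hasDerivAt
    (fun v _ => hasDerivAt_mnlProb_segment d f₁ f₂ a v)
    ((continuous_mnlCurv_segment_mulVec d f₁ f₂ _ a).intervalIntegrable _ _)]
  simp

theorem mnlAvgCurv_posSemidef {M q : ℕ} (d : Fin q → ℝ) (f₁ f₂ : Fin M → Fin q → ℝ) :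
    (mnlAvgCurv d f₁ f₂).PosSemidef := by
  refine Matrix.PosSemidef.of_dotProduct_mulVec_nonneg ?_ fun s => ?_
  · ext a b
    simp only [Matrix.conjTranspose_apply, mnlAvgCurv, star_trivial]
    simp_rw [mnlCurv_symm d _ b a]
  · have hquad : star s ⬝ᵥ (mnlAvgCurv d f₁ f₂ *ᵥ s) =
        ∫ v in (0 : ℝ)..1, s ⬝ᵥ (mnlCurv d (v • f₁ + (1 - v) • f₂) *ᵥ s) := by
      simp only [dotProduct, star_trivial, mnlAvgCurv_mulVec]
      rw [intervalIntegral.integral_finsetSum fun a _ =>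
        (continuous_const.fun_mul
          (continuous_mnlCurv_segment_mulVec d f₁ f₂ s a)).intervalIntegrable _ _]
      simp only [intervalIntegral.integral_const_mul]
    rw [hquad]
    exact intervalIntegral.integral_nonneg zero_le_one fun v _ =>
      dotProduct_mnlCurv_mulVec_nonneg d _ s

theorem mnlDesign_posDef {M q : ℕ} {J : Type*} [Fintype J] {lam : ℝ} (hlam : 0 < lam)
    (d : J → Fin q → ℝ) (f₁ f₂ : Fin M → Fin q → ℝ) : (mnlDesign lam d f₁ f₂).PosDef := by
  refine Matrix.PosDef.add_posSemidef (Matrix.PosDef.one.smul hlam)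
    (Matrix.posSemidef_sum _ fun j _ => (mnlAvgCurv_posSemidef (d j) f₁ f₂).kronecker ?_)
  simpa using Matrix.posSemidef_vecMulVec_self_star (d j)

theorem kronecker_vecMulVec_mulVec_vecFlatten {M q : ℕ} (B : Matrix (Fin M) (Fin M) ℝ)
    (d : Fin q → ℝ) (f : Fin M → Fin q → ℝ) (p : Fin M × Fin q) :
    ((B ⊗ₖ Matrix.vecMulVec d d) *ᵥ vecFlatten f) p = (B *ᵥ fun b => f b ⬝ᵥ d) p.1 * d p.2 := by
  simp only [Matrix.mulVec, dotProduct, vecFlatten, Matrix.kroneckerMap_apply,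
    Matrix.vecMulVec_apply, Fintype.sum_prod_type, Finset.sum_mul, Finset.mul_sum]
  exact Finset.sum_congr rfl fun a _ => Finset.sum_congr rfl fun x _ => by ring

theorem mnlDesign_mulVec_sub {M q : ℕ} {J : Type*} [Fintype J] (lam : ℝ)
    (d : J → Fin q → ℝ) (f₁ f₂ : Fin M → Fin q → ℝ) :
    mnlDesign lam d f₁ f₂ *ᵥ vecFlatten (f₁ - f₂) =
      vecFlatten (mnlGradMap lam d f₁ - mnlGradMap lam d f₂) := by
  funext p
  simp only [mnlDesign, Matrix.add_mulVec, Matrix.sum_mulVec, Matrix.smul_mulVec,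
    Matrix.one_mulVec, Pi.add_apply, Finset.sum_apply, Pi.smul_apply,
    kronecker_vecMulVec_mulVec_vecFlatten, Pi.sub_apply, mnlAvgCurv_mulVec_sub]
  simp only [vecFlatten, mnlGradMap, Pi.sub_apply, Pi.add_apply, Pi.smul_apply, smul_eq_mul,
    Finset.sum_apply, sub_mul, Finset.sum_sub_distrib]
  ring

theorem mnlGradMap_monotone {M q : ℕ} {J : Type*} [Fintype J] {lam : ℝ} (hlam : 0 < lam)
    (d : J → Fin q → ℝ) (f₁ f₂ : Fin M → Fin q → ℝ) :
    0 ≤ vecFlatten (f₁ - f₂) ⬝ᵥ vecFlatten (mnlGradMap lam d f₁ - mnlGradMap lam d f₂) := by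
  rw [← mnlDesign_mulVec_sub]
  simpa using (mnlDesign_posDef hlam d f₁ f₂).posSemidef.dotProduct_mulVec_nonneg
    (vecFlatten (f₁ - f₂))

theorem hasDerivAt_mnlLogLik_segment {M q : ℕ} {J : Type*} [Fintype J] (lam : ℝ)
    (d : J → Fin q → ℝ) (c : J → Fin (M + 1)) (f₁ f₂ : Fin M → Fin q → ℝ) (v : ℝ) :
    HasDerivAt (fun v : ℝ => mnlLogLik lam d c (v • f₁ + (1 - v) • f₂))
      ((∑ j, if h : (c j : ℕ) < M then (f₁ ⟨c j, h⟩ - f₂ ⟨c j, h⟩) ⬝ᵥ d j else 0) -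
        vecFlatten (f₁ - f₂) ⬝ᵥ vecFlatten (mnlGradMap lam d (v • f₁ + (1 - v) • f₂))) v := by
  have hcoord (i : Fin M) (x : Fin q) :
      HasDerivAt (fun v : ℝ => (v • f₁ + (1 - v) • f₂) i x) (f₁ i x - f₂ i x) v := by
    simpa [dotProduct_single] using
      hasDerivAt_segment_dotProduct (Pi.single x (1 : ℝ)) f₁ f₂ i v
  have hsq := (HasDerivAt.fun_sum (u := Finset.univ) fun i _ =>
    HasDerivAt.fun_sum (u := Finset.univ) fun x _ => (hcoord i x).fun_pow 2).const_mul (lam / 2)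
  have hlog := HasDerivAt.fun_sum (u := Finset.univ) fun j _ =>
    hasDerivAt_log_mnlProbFull_segment (d j) f₁ f₂ (c j) v
  refine (hlog.sub hsq).congr_deriv ?_
  rw [Finset.sum_sub_distrib, sub_sub]
  congr 1
  generalize v • f₁ + (1 - v) • f₂ = f
  simp only [dotProduct, vecFlatten, Fintype.sum_prod_type, mnlGradMap, Pi.add_apply,
    Pi.sub_apply, Pi.smul_apply, smul_eq_mul, Finset.sum_apply, mul_add, Finset.sum_add_distrib,
    Finset.mul_sum]
  rw [add_comm]
  congr 1
  · exact Finset.sum_congr rfl fun i _ => Finset.sum_congr rfl fun x _ => by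
      norm_num; ring
  · rw [Finset.sum_comm]
    refine Finset.sum_congr rfl fun i _ => ?_
    rw [Finset.sum_comm]
    exact Finset.sum_congr rfl fun x _ => Finset.sum_congr rfl fun j _ => by ring

/-- At a maximizer the gap is controlled by the gradient increment, by convexity of `-L`. -/
theorem mnlLogLik_gap_le_dotProduct {M q : ℕ} {J : Type*} [Fintype J] {lam : ℝ}
    (hlam : 0 < lam) (d : J → Fin q → ℝ) (c : J → Fin (M + 1)) (fhat f : Fin M → Fin q → ℝ)
    (hmax : ∀ f : Fin M → Fin q → ℝ, mnlLogLik lam d c f ≤ mnlLogLik lam d c fhat) :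
    mnlLogLik lam d c fhat - mnlLogLik lam d c f ≤
      vecFlatten (f - fhat) ⬝ᵥ vecFlatten (mnlGradMap lam d f - mnlGradMap lam d fhat) := by
  have hderiv := hasDerivAt_mnlLogLik_segment lam d c f fhat
  have hstat := IsLocalMax.hasDerivAt_eq_zero
    (Filter.Eventually.of_forall fun v => by simpa using hmax _) (hderiv 0)
  obtain ⟨ξ, hξ, hslope⟩ := exists_hasDerivAt_eq_slope _ _ (zero_lt_one' ℝ)
    (fun v _ => (hderiv v).continuousAt.continuousWithinAt) fun v _ => hderiv v
  have hmono := mnlGradMap_monotone hlam d f (ξ • f + (1 - ξ) • fhat)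
  have hseg : f - (ξ • f + (1 - ξ) • fhat) = (1 - ξ) • (f - fhat) := by
    module
  have hsmul : vecFlatten ((1 - ξ) • (f - fhat)) = (1 - ξ) • vecFlatten (f - fhat) := rfl
  have hsub (g₁ g₂ : Fin M → Fin q → ℝ) :
      vecFlatten (g₁ - g₂) = vecFlatten g₁ - vecFlatten g₂ := rfl
  rw [hseg, hsmul, smul_dotProduct, smul_eq_mul] at hmono
  have hinc := nonneg_of_mul_nonneg_right hmono (sub_pos.2 hξ.2)
  rw [hsub (mnlGradMap _ _ _), dotProduct_sub] at hinc ⊢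
  simp only [zero_smul, sub_zero, one_smul, zero_add, sub_self, add_zero, div_one] at hslope hstat
  linarith

/-- **Likelihood-gap Taylor inequality.** `G(f¹, f²)` is symmetric positive definite (hence
invertible), and if `f̂` is a global maximizer of the regularized multinomial logistic
log-likelihood `L`, then for every `f`,
`L(f̂) - L(f) ≤ (g(f) - g(f̂))ᵀ G(f, f̂)⁻¹ (g(f) - g(f̂))`. -/
theorem mnl_likelihood_gap_bound (M q : ℕ) (hM : 1 ≤ M) (hq : 1 ≤ q)
    (lam : ℝ) (hlam : 0 < lam) {J : Type*} [Fintype J]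
    (d : J → Fin q → ℝ) (c : J → Fin (M + 1))
    (fhat : Fin M → Fin q → ℝ)
    (hmax : ∀ f : Fin M → Fin q → ℝ, mnlLogLik lam d c f ≤ mnlLogLik lam d c fhat) :
    (∀ f₁ f₂ : Fin M → Fin q → ℝ, (mnlDesign lam d f₁ f₂).PosDef) ∧
    ∀ f : Fin M → Fin q → ℝ,
      mnlLogLik lam d c fhat - mnlLogLik lam d c f ≤
        vecFlatten (mnlGradMap lam d f - mnlGradMap lam d fhat) ⬝ᵥ
          ((mnlDesign lam d f fhat)⁻¹ *ᵥ
            vecFlatten (mnlGradMap lam d f - mnlGradMap lam d fhat)) := by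
  refine ⟨mnlDesign_posDef hlam d, fun f => ?_⟩
  have hunit := (mnlDesign_posDef hlam d f fhat).isUnit
  have hinv : (mnlDesign lam d f fhat)⁻¹ *ᵥ
      vecFlatten (mnlGradMap lam d f - mnlGradMap lam d fhat) = vecFlatten (f - fhat) := by
    rw [← mnlDesign_mulVec_sub, Matrix.mulVec_mulVec,
      Matrix.nonsing_inv_mul _ ((Matrix.isUnit_iff_isUnit_det _).1 hunit), Matrix.one_mulVec]
  rw [hinv, dotProduct_comm]
  exact mnlLogLik_gap_le_dotProduct hlam d c fhat f hmax
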